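/- arXiv:1404.1197 — 2 statements merged into one kernel-verified Lean document; each statement's English description precedes it below -/
import Mathlib

section
/- Liouville theorem for translation-invariant extremal inequalities in ℝⁿ: let s ∈ (0,1) and ᾱ > 0 be the interior Hölder exponent of the Caffarelli–Silvestre class L_0(s). Suppose u ∈ C(ℝⁿ) satisfies in the viscosity sense M⁺{u(·+h) − u} ≥ 0 and M⁻{u(·+h) − u} ≤ 0 in ℝⁿ for all h ∈ ℝⁿ, and for some β ∈ (0,1) and α ∈ (0,ᾱ) the bound [u]_{C^β(B_R)} ≤ C R^α holds for all R ≥ 1. Then u is affine: u(x) = p·x + b. -/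
open MeasureTheory Metric Set
open scoped RealInnerProductSpace

/-- Spectral measures of the class `L_*`: measurable, even, `lam ≤ μ ≤ Lam` on the sphere. -/
def SpecOK (n : ℕ) (lam Lam : ℝ) (μ : EuclideanSpace ℝ (Fin n) → ℝ) : Prop :=
  Measurable μ ∧ ∀ θ : EuclideanSpace ℝ (Fin n), ‖θ‖ = 1 →
    μ (-θ) = μ θ ∧ lam ≤ μ θ ∧ μ θ ≤ Lam

/-- The operator of the class `L_*(s)` with spectral measure `μ`. -/
noncomputable def kerOp (n : ℕ) (s : ℝ) (μ u : EuclideanSpace ℝ (Fin n) → ℝ)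
    (x : EuclideanSpace ℝ (Fin n)) : ℝ :=
  (1 - s) * ∫ y : EuclideanSpace ℝ (Fin n),
    ((u (x + y) + u (x - y)) / 2 - u x) * μ (‖y‖⁻¹ • y) / ‖y‖ ^ ((n : ℝ) + 2 * s)

/-- Extremal operator `M⁺` of the class `L_*(s)`. -/
noncomputable def Mplus (n : ℕ) (s lam Lam : ℝ) (u : EuclideanSpace ℝ (Fin n) → ℝ)
    (x : EuclideanSpace ℝ (Fin n)) : ℝ :=
  sSup {z : ℝ | ∃ μ, SpecOK n lam Lam μ ∧ z = kerOp n s μ u x}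

/-- Extremal operator `M⁻` of the class `L_*(s)`. -/
noncomputable def Mminus (n : ℕ) (s lam Lam : ℝ) (u : EuclideanSpace ℝ (Fin n) → ℝ)
    (x : EuclideanSpace ℝ (Fin n)) : ℝ :=
  sInf {z : ℝ | ∃ μ, SpecOK n lam Lam μ ∧ z = kerOp n s μ u x}

/-- `w` satisfies `M⁺ w ≥ 0` in `Ω` in the viscosity sense: whenever a `C²` function `φ`
touches `w` from above at `x` in a ball contained in `Ω`, the operator evaluated on
`φ` in the ball and `w` outside is nonnegative at `x`. -/
def ViscSub (n : ℕ) (s lam Lam : ℝ) (w : EuclideanSpace ℝ (Fin n) → ℝ)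
    (Ω : Set (EuclideanSpace ℝ (Fin n))) : Prop :=
  ∀ x ∈ Ω, ∀ r : ℝ, 0 < r → ball x r ⊆ Ω →
    ∀ φ : EuclideanSpace ℝ (Fin n) → ℝ, ContDiffOn ℝ 2 φ (ball x r) → φ x = w x →
      (∀ y ∈ ball x r, w y ≤ φ y) →
      0 ≤ Mplus n s lam Lam (fun y => if ‖y - x‖ < r then φ y else w y) x

/-- `w` satisfies `M⁻ w ≤ 0` in `Ω` in the viscosity sense: whenever a `C²` function `φ`
touches `w` from below at `x` in a ball contained in `Ω`, the operator evaluated on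
`φ` in the ball and `w` outside is nonpositive at `x`. -/
def ViscSuper (n : ℕ) (s lam Lam : ℝ) (w : EuclideanSpace ℝ (Fin n) → ℝ)
    (Ω : Set (EuclideanSpace ℝ (Fin n))) : Prop :=
  ∀ x ∈ Ω, ∀ r : ℝ, 0 < r → ball x r ⊆ Ω →
    ∀ φ : EuclideanSpace ℝ (Fin n) → ℝ, ContDiffOn ℝ 2 φ (ball x r) → φ x = w x →
      (∀ y ∈ ball x r, φ y ≤ w y) →
      Mminus n s lam Lam (fun y => if ‖y - x‖ < r then φ y else w y) x ≤ 0



open scoped Pointwise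

abbrev EE (d : ℕ) := EuclideanSpace ℝ (Fin (d + 1))

theorem mint_integrable (d : ℕ) (s : ℝ) (hs0 : 0 < s) (hs1 : s < 1) :
    Integrable (fun y : EE d => min (‖y‖ ^ (2:ℝ)) (‖y‖ ^ s) / ‖y‖ ^ (((d + 1 : ℕ) : ℝ) + 2 * s)) := by
  have := (integrable_fun_norm_addHaar (volume : Measure (EE d))
    (f := fun t : ℝ => min (t ^ (2:ℝ)) (t ^ s) / t ^ (((d + 1 : ℕ) : ℝ) + 2 * s))).2
  apply this
  have hmeas : Measurable (fun y : ℝ => y ^ (Module.finrank ℝ (EE d) - 1) •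
      (min (y ^ (2:ℝ)) (y ^ s) / y ^ (((d + 1 : ℕ) : ℝ) + 2 * s))) := by fun_prop
  have key : ∀ y : ℝ, 0 < y → ∀ a : ℝ, 
      y ^ (Module.finrank ℝ (EE d) - 1) * (y ^ a / y ^ (((d + 1 : ℕ) : ℝ) + 2 * s))
        = y ^ (a - 1 - 2 * s) := by
    intro y hy a
    rw [finrank_euclideanSpace_fin, Nat.add_sub_cancel, ← Real.rpow_natCast, ← Real.rpow_sub hy,
      ← Real.rpow_add hy]
    congr 1
    push_cast
    ring
  have h01 : IntegrableOn (fun x : ℝ => x ^ (2 - 1 - 2 * s)) (Ioo 0 2) := by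
    rw [intervalIntegral.integrableOn_Ioo_rpow_iff (by norm_num)]
    linarith
  have h1 : IntegrableOn (fun x : ℝ => x ^ (s - 1 - 2 * s)) (Ioi 1) :=
    integrableOn_Ioi_rpow_of_lt (by linarith) one_pos
  have hU : Ioi (0:ℝ) = Ioo 0 2 ∪ Ioi 1 := by
    ext x; simp only [mem_Ioi, mem_union, mem_Ioo]
    constructor
    · intro h
      by_cases h2 : x < 2
      · exact Or.inl ⟨h, h2⟩
      · right; linarith
    · rintro (h | h) <;> linarith [h]
  rw [hU]
  refine IntegrableOn.union ?_ ?_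
  · refine Integrable.mono' h01 hmeas.aestronglyMeasurable ?_
    refine (ae_restrict_iff' measurableSet_Ioo).2 (.of_forall fun y hy => ?_)
    have hy0 : 0 < y := hy.1
    rw [← key y hy0, Real.norm_of_nonneg (by rw [smul_eq_mul]; positivity), smul_eq_mul]
    gcongr
    exact min_le_left _ _
  · refine Integrable.mono' h1 hmeas.aestronglyMeasurable ?_
    refine (ae_restrict_iff' measurableSet_Ioi).2 (.of_forall fun y hy => ?_)
    have hy0 : 0 < y := lt_trans one_pos hy
    rw [← key y hy0, Real.norm_of_nonneg (by rw [smul_eq_mul]; positivity), smul_eq_mul]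
    gcongr
    exact min_le_right _ _

theorem kerOp_neg (n : ℕ) (s : ℝ) (μ u : EuclideanSpace ℝ (Fin n) → ℝ)
    (x : EuclideanSpace ℝ (Fin n)) : kerOp n s μ (fun y => - u y) x = - kerOp n s μ u x := by
  unfold kerOp
  rw [← mul_neg, ← integral_neg]
  congr 2
  ext y
  ring

theorem Mplus_neg (n : ℕ) (s lam Lam : ℝ) (u : EuclideanSpace ℝ (Fin n) → ℝ)
    (x : EuclideanSpace ℝ (Fin n)) :
    Mplus n s lam Lam (fun y => - u y) x = - Mminus n s lam Lam u x := by
  unfold Mplus Mminus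
  rw [Real.sInf_def, neg_neg]
  congr 1
  ext z
  simp only [Set.mem_ofPred_eq, Set.mem_neg, kerOp_neg]
  constructor
  · rintro ⟨μ, h, rfl⟩; exact ⟨μ, h, by simp⟩
  · rintro ⟨μ, h, h'⟩; exact ⟨μ, h, by linarith⟩

theorem ViscSuper.neg_sub {n : ℕ} {s lam Lam : ℝ} {w : EuclideanSpace ℝ (Fin n) → ℝ}
    (h : ViscSuper n s lam Lam w univ) : ViscSub n s lam Lam (fun x => - w x) univ := by
  intro x hx r hr hb φ hφ hφx hle
  have := h x hx r hr hb (fun y => - φ y) hφ.neg (by simp [hφx])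
    (fun y hy => by have := hle y hy; linarith)
  have h2 := Mplus_neg n s lam Lam (fun y => if ‖y - x‖ < r then - φ y else w y) x
  have h3 : (fun y => - (if ‖y - x‖ < r then - φ y else w y))
      = (fun y => if ‖y - x‖ < r then φ y else - w y) := by
    ext y; split_ifs <;> simp
  rw [h3] at h2
  rw [h2]
  linarith

theorem kerOp_scale (n : ℕ) (s : ℝ) (μ u : EuclideanSpace ℝ (Fin n) → ℝ)
    (x : EuclideanSpace ℝ (Fin n)) (c b R : ℝ) (hR : 0 < R) :
    kerOp n s μ (fun y => c * (u (R • y) - b)) x = (c * R ^ (2 * s)) * kerOp n s μ u (R • x) := by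
  unfold kerOp
  have h := Measure.integral_comp_smul (volume : Measure (EuclideanSpace ℝ (Fin n)))
    (fun y => ((u (R • x + y) + u (R • x - y)) / 2 - u (R • x)) * μ (‖y‖⁻¹ • y) /
      ‖y‖ ^ ((n : ℝ) + 2 * s)) R
  rw [finrank_euclideanSpace_fin, abs_of_pos (by positivity), smul_eq_mul] at h
  have h2 : (∫ y : EuclideanSpace ℝ (Fin n),
      ((u (R • x + y) + u (R • x - y)) / 2 - u (R • x)) * μ (‖y‖⁻¹ • y) /
      ‖y‖ ^ ((n : ℝ) + 2 * s)) = R ^ n * ∫ y : EuclideanSpace ℝ (Fin n),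
      ((u (R • x + R • y) + u (R • x - R • y)) / 2 - u (R • x)) * μ (‖R • y‖⁻¹ • R • y) /
      ‖R • y‖ ^ ((n : ℝ) + 2 * s) := by
    rw [h]; field_simp
  rw [h2, mul_left_comm]
  congr 1
  rw [← mul_assoc, ← integral_const_mul]
  congr 1
  ext y
  have e1 : ‖R • y‖⁻¹ • R • y = ‖y‖⁻¹ • y := by
    rw [norm_smul, smul_smul, Real.norm_of_nonneg hR.le]
    congr 1
    field_simp
  have e2 : ‖R • y‖ ^ ((n : ℝ) + 2 * s) = R ^ n * R ^ (2 * s) * ‖y‖ ^ ((n : ℝ) + 2 * s) := by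
    rw [norm_smul, Real.norm_of_nonneg hR.le, Real.mul_rpow hR.le (norm_nonneg _),
      Real.rpow_add hR, Real.rpow_natCast]
  rw [e1, e2]
  simp only [smul_add, smul_sub]
  have : 0 < R ^ (2 * s) := by positivity
  field_simp
  ring

theorem ViscSub.scale {n : ℕ} {s lam Lam : ℝ} {w : EuclideanSpace ℝ (Fin n) → ℝ}
    (h : ViscSub n s lam Lam w univ) (c b R : ℝ) (hc : 0 < c) (hR : 0 < R) :
    ViscSub n s lam Lam (fun x => c * (w (R • x) - b)) univ := by
  intro x hx r hr hb φ hφ hφx hle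
  have hmap : ∀ y ∈ ball (R • x) (R * r), R⁻¹ • y ∈ ball x r := by
    intro y hy
    rw [mem_ball, dist_eq_norm] at hy ⊢
    have : y - R • x = R • (R⁻¹ • y - x) := by rw [smul_sub, smul_inv_smul₀ hR.ne']
    rw [this, norm_smul, Real.norm_of_nonneg hR.le] at hy
    exact lt_of_mul_lt_mul_left hy hR.le
  have := h (R • x) (mem_univ _) (R * r) (by positivity) (subset_univ _)
    (fun y => φ (R⁻¹ • y) / c + b) ?_ ?_ ?_
  · have h3 : (fun y => if ‖y - x‖ < r then φ y else c * (w (R • y) - b)) =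
      (fun y => c * ((fun y => if ‖y - R • x‖ < R * r then φ (R⁻¹ • y) / c + b else w y) (R • y)
        - b)) := by
      ext y
      have : ‖R • y - R • x‖ < R * r ↔ ‖y - x‖ < r := by
        rw [← smul_sub, norm_smul, Real.norm_of_nonneg hR.le]
        exact mul_lt_mul_iff_right₀ hR
      simp only [this, inv_smul_smul₀ hR.ne']
      split_ifs
      · field_simp; ring
      · rfl
    rw [h3]
    unfold Mplus at this ⊢
    have h4 : ∀ v : EuclideanSpace ℝ (Fin n) → ℝ,
        {z : ℝ | ∃ μ, SpecOK n lam Lam μ ∧ z = kerOp n s μ (fun y => c * (v (R • y) - b)) x}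
        = (c * R ^ (2 * s)) • {z : ℝ | ∃ μ, SpecOK n lam Lam μ ∧ z = kerOp n s μ v (R • x)} := by
      intro v
      ext z
      simp only [Set.mem_ofPred_eq, Set.mem_smul_set, kerOp_scale n s _ v x c b R hR]
      constructor
      · rintro ⟨μ, h, rfl⟩; exact ⟨_, ⟨μ, h, rfl⟩, rfl⟩
      · rintro ⟨_, ⟨μ, h, rfl⟩, rfl⟩; exact ⟨μ, h, rfl⟩
    rw [h4 (fun y => if ‖y - R • x‖ < R * r then φ (R⁻¹ • y) / c + b else w y), Real.sSup_smul_of_nonneg (by positivity)]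
    exact smul_nonneg (by positivity) this
  · refine ContDiffOn.add (ContDiffOn.div_const ?_ c) contDiffOn_const
    refine hφ.comp (by fun_prop) hmap
  · simp only [inv_smul_smul₀ hR.ne', hφx]; field_simp; ring
  · intro y hy
    have := hle _ (hmap y hy)
    simp only [smul_inv_smul₀ hR.ne'] at this ⊢
    rw [← sub_le_iff_le_add, le_div_iff₀ hc]
    linarith

set_option maxHeartbeats 4000000 in
theorem key_lemma (d : ℕ) (s lam Lam : ℝ) (hs0 : 0 < s) (hs1 : s < 1)
    (hlam : 0 < lam) (hlL : lam ≤ Lam) : ∃ ε : ℝ, 0 < ε ∧ ε ≤ 1 ∧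
     ∀ w : EE d → ℝ, Continuous w → ViscSub (d + 1) s lam Lam w univ →
      ∀ A : ℝ, (∀ x, |w x| ≤ A * (1 + ‖x‖) ^ s) → (∀ x, w x ≤ ε * (1 + ‖x‖) ^ s) →
      ∀ x0, ‖x0‖ ≤ 1 → -ε ≤ w x0 →
      volume (ball (0 : EE d) 1) ≤ 2 * volume {x ∈ ball (0 : EE d) 1 | w x ≤ -(1/4)} → False := by
  have hLam : 0 < Lam := by linarith
  set p : ℝ := ((d + 1 : ℕ) : ℝ) + 2 * s with hp
  have hp0 : 0 < p := by positivity
  have hJint := mint_integrable d s hs0 hs1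
  rw [← hp] at hJint
  set J : EE d → ℝ := fun y => min (‖y‖ ^ (2:ℝ)) (‖y‖ ^ s) / ‖y‖ ^ p with hJ
  have hJ0 : ∀ y, 0 ≤ J y := fun y => by simp only [hJ]; positivity
  set I : ℝ := ∫ y, J y with hI
  have hI0 : 0 ≤ I := integral_nonneg hJ0
  set V : ℝ := volume.real (ball (0 : EE d) 1) with hV
  have hV0 : 0 < V := by
    rw [hV, measureReal_def]
    exact ENNReal.toReal_pos (measure_ball_pos _ _ one_pos).ne' measure_ball_lt_top.ne
  set q : ℝ := lam / 16 / 3 ^ p with hq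
  have hq0 : 0 < q := by positivity
  set ε : ℝ := min (1/64) (q * (V / 4) / (10 * Lam * (I + 1))) with hε
  have hε0 : 0 < ε := by
    refine lt_min (by norm_num) ?_
    positivity
  have hε64 : ε ≤ 1/64 := min_le_left _ _
  have hεI : 5 * ε * Lam * I ≤ q * (V / 4) / 2 := by
    have h1 : ε * (10 * Lam * (I + 1)) ≤ q * (V / 4) :=
      (le_div_iff₀ (by positivity)).1 (min_le_right _ _)
    have : 0 < ε * Lam := by positivity
    nlinarith
  refine ⟨ε, hε0, by linarith, ?_⟩
  clear_value ε I V q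
  intro w hw hsub A hA hup x0 hx0 hwx0 hvol
  have hA0 : 0 ≤ A := by
    have := (abs_nonneg _).trans (hA 0)
    simpa using this
  -- the touching point
  obtain ⟨x1, hx1, hmax⟩ := (isCompact_closedBall x0 1).exists_isMaxOn
    (f := fun x => w x - 5 * ε * ‖x - x0‖ ^ 2) ⟨x0, by simp⟩ (by fun_prop)
  have hm0 : w x0 ≤ w x1 - 5 * ε * ‖x1 - x0‖ ^ 2 := by
    have := hmax (mem_closedBall_self zero_le_one : x0 ∈ closedBall x0 1)
    simpa using this
  have hx1' : ‖x1 - x0‖ ≤ 1 := by rwa [mem_closedBall, dist_eq_norm] at hx1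
  have hx12 : ‖x1‖ ≤ 2 := by
    have := norm_add_le (x1 - x0) x0
    rw [sub_add_cancel] at this
    linarith
  have hwx1 : -ε ≤ w x1 := by nlinarith [sq_nonneg ‖x1 - x0‖]
  set φ : EE d → ℝ := fun x => w x1 + 5 * ε * ‖x - x0‖ ^ 2 - 5 * ε * ‖x1 - x0‖ ^ 2 with hφ
  have htouch : ∀ x, w x ≤ φ x := by
    intro x
    simp only [hφ]
    by_cases hx : x ∈ closedBall x0 1
    · have := hmax hx
      simp only [Set.mem_ofPred_eq] at this
      linarith
    · rw [mem_closedBall, dist_eq_norm, not_le] at hx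
      have h1 := hup x
      have h2 : ‖x‖ ≤ ‖x - x0‖ + 1 := by
        have := norm_add_le (x - x0) x0
        rw [sub_add_cancel] at this
        linarith
      have h3 : (1 + ‖x‖) ^ s ≤ 1 + ‖x‖ :=
        Real.rpow_le_self_of_one_le (by linarith [norm_nonneg x]) hs1.le
      have h4 : w x ≤ ε * (2 + ‖x - x0‖) := 
        h1.trans (mul_le_mul_of_nonneg_left (by linarith) hε0.le)
      have h5 : ε * (2 + ‖x - x0‖) ≤ ε * (5 * ‖x - x0‖ ^ 2 - 1) :=
        mul_le_mul_of_nonneg_left (by nlinarith) hε0.le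
      linarith
  set g : EE d → ℝ := fun y => if ‖y - x1‖ < 1/4 then φ y else w y with hg
  have hM := hsub x1 (mem_univ _) (1/4) (by norm_num) (subset_univ _) φ
    (by
      have : ContDiff ℝ 2 φ := by
        simp only [hφ]
        exact ((contDiff_const.add (contDiff_const.mul
          ((contDiff_id.sub contDiff_const).norm_sq ℝ))).sub contDiff_const)
      exact this.contDiffOn)
    (by simp [hφ]) (fun y _ => htouch y)
  set D : EE d → ℝ := fun y => (g (x1 + y) + g (x1 - y)) / 2 - g x1 with hD
  have hgx1 : g x1 = w x1 := by simp [hg, hφ]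
  have hgle : ∀ y, g y ≤ φ y := by
    intro y; simp only [hg]; split_ifs
    · exact le_rfl
    · exact htouch y
  have hpar : ∀ y, (φ (x1 + y) + φ (x1 - y)) / 2 - w x1 = 5 * ε * ‖y‖ ^ 2 := by
    intro y
    have := parallelogram_law_with_norm ℝ (x1 - x0) y
    rw [show x1 - x0 + y = x1 + y - x0 by abel, show x1 - x0 - y = x1 - y - x0 by abel] at this
    simp only [hφ]
    nlinarith
  have hin : ∀ y, ‖y‖ < 1/4 → D y = 5 * ε * ‖y‖ ^ 2 := by
    intro y hy
    simp only [hD, hgx1]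
    rw [← hpar y]
    simp [hg, show ‖y‖ < 4⁻¹ by linarith]
  have hout : ∀ y, 1/4 ≤ ‖y‖ → D y = (w (x1 + y) + w (x1 - y)) / 2 - w x1 := by
    intro y hy
    simp only [hD, hgx1]
    simp [hg, show ¬ ‖y‖ < 4⁻¹ by linarith]
  have hD1 : ∀ y, D y ≤ 5 * ε * ‖y‖ ^ 2 := by
    intro y
    rw [← hpar y]
    simp only [hD, hgx1]
    linarith [hgle (x1 + y), hgle (x1 - y)]
  have hnp : ∀ y, 1 + ‖x1 + y‖ ≤ 3 + ‖y‖ := fun y => by linarith [norm_add_le x1 y]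
  have hnm : ∀ y, 1 + ‖x1 - y‖ ≤ 3 + ‖y‖ := fun y => by linarith [norm_sub_le x1 y]
  have hup' : ∀ x t : _, 1 + ‖x‖ ≤ t → w x ≤ ε * t ^ s := fun x t h =>
    (hup x).trans (by gcongr)
  have hD5 : ∀ y, D y ≤ 5 * ε * min (‖y‖ ^ (2:ℝ)) (‖y‖ ^ s) := by
    intro y
    have h1 := hD1 y
    rw [mul_min_of_nonneg _ _ (by positivity), le_min_iff, Real.rpow_two]
    refine ⟨h1, ?_⟩
    rcases le_total ‖y‖ 1 with h | h
    · refine h1.trans ?_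
      rw [← Real.rpow_two]
      rcases (norm_nonneg y).eq_or_lt with h0 | h0
      · rw [← h0, Real.zero_rpow hs0.ne']; simp
      · gcongr ?_ * ?_
        exact Real.rpow_le_rpow_of_exponent_ge h0 h (by linarith)
    · rw [hout y (by linarith)]
      have h2 := hup' _ _ ((hnp y).trans (show 3 + ‖y‖ ≤ 4 * ‖y‖ by linarith))
      have h3 := hup' _ _ ((hnm y).trans (show 3 + ‖y‖ ≤ 4 * ‖y‖ by linarith))
      have h4 : (4 * ‖y‖) ^ s ≤ 4 * ‖y‖ ^ s := by
        rw [Real.mul_rpow (by norm_num) (norm_nonneg _)]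
        gcongr
        exact Real.rpow_le_self_of_one_le (by norm_num) hs1.le
      have h5 : 1 ≤ ‖y‖ ^ s := Real.one_le_rpow h hs0.le
      nlinarith
  have hDabs : ∀ y, |D y| ≤ (5 * ε + 416 * A) * min (‖y‖ ^ (2:ℝ)) (‖y‖ ^ s) := by
    intro y
    have hmin0 : 0 ≤ min (‖y‖ ^ (2:ℝ)) (‖y‖ ^ s) := by positivity
    rcases lt_or_ge ‖y‖ (1/4) with h | h
    · have h1 : |D y| = D y := abs_of_nonneg (by rw [hin y h]; positivity)
      rw [h1]
      nlinarith [hD5 y, mul_nonneg hA0 hmin0]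
    · rw [hout y h]
      have hA' : ∀ x, 1 + ‖x‖ ≤ 3 + ‖y‖ → |w x| ≤ A * (13 * ‖y‖ ^ s) := by
        intro x hx
        refine (hA x).trans ?_
        gcongr
        calc (1 + ‖x‖) ^ s ≤ (13 * ‖y‖) ^ s := by gcongr; linarith
          _ = 13 ^ s * ‖y‖ ^ s := Real.mul_rpow (by norm_num) (norm_nonneg _)
          _ ≤ 13 * ‖y‖ ^ s := by
            gcongr
            exact Real.rpow_le_self_of_one_le (by norm_num) hs1.le
      have a1 := hA' _ (hnp y)
      have a2 := hA' _ (hnm y)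
      have a3 := hA' x1 (by linarith)
      have hmin : ‖y‖ ^ s ≤ 16 * min (‖y‖ ^ (2:ℝ)) (‖y‖ ^ s) := by
        have hs' : 0 ≤ ‖y‖ ^ s := by positivity
        rw [mul_min_of_nonneg _ _ (by norm_num), le_min_iff]
        refine ⟨?_, by linarith⟩
        rcases le_total ‖y‖ 1 with h' | h'
        · have : ‖y‖ ^ s ≤ 1 := Real.rpow_le_one (norm_nonneg _) h' hs0.le
          rw [Real.rpow_two]
          nlinarith
        · have := Real.rpow_le_rpow_of_exponent_le h' (show s ≤ 2 by linarith)
          have h0 : 0 ≤ ‖y‖ ^ (2:ℝ) := by positivity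
          linarith
      have hb : |(w (x1 + y) + w (x1 - y)) / 2 - w x1| ≤ 26 * A * ‖y‖ ^ s := by
        rw [abs_le] at a1 a2 a3 ⊢
        constructor <;> nlinarith
      refine hb.trans ?_
      calc 26 * A * ‖y‖ ^ s ≤ 26 * A * (16 * min (‖y‖ ^ (2:ℝ)) (‖y‖ ^ s)) := by gcongr
        _ ≤ _ := by nlinarith [mul_nonneg hε0.le hmin0]
  -- the good set
  set G0 : Set (EE d) := {x ∈ ball (0 : EE d) 1 | w x ≤ -(1/4)} with hG0
  set G : Set (EE d) := {y | x1 + y ∈ G0 ∧ 1/4 ≤ ‖y‖} with hG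
  have hG0m : MeasurableSet G0 :=
    measurableSet_ball.inter (measurableSet_le hw.measurable measurable_const)
  have hGm : MeasurableSet G :=
    ((measurable_const_add x1) hG0m).inter (measurableSet_le measurable_const measurable_norm)
  have hGle : ∀ y ∈ G, ‖y‖ ≤ 3 := by
    rintro y ⟨⟨hy, _⟩, _⟩
    rw [mem_ball_zero_iff] at hy
    have := norm_sub_le (x1 + y) x1
    rw [add_sub_cancel_left] at this
    linarith
  have hGfin : volume G ≠ ⊤ := by
    refine ((measure_mono (t := closedBall (0 : EE d) 3) ?_).trans_lt measure_closedBall_lt_top).ne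
    intro y hy
    rw [mem_closedBall_zero_iff]
    exact hGle y hy
  have hDG : ∀ y ∈ G, D y ≤ -(1/16) := by
    intro y hy
    have h3 := hGle y hy
    obtain ⟨⟨_, hy1⟩, hy2⟩ := hy
    rw [hout y hy2]
    have h1 := hup' _ _ ((hnm y).trans (show 3 + ‖y‖ ≤ 6 by linarith))
    have h4 : (6:ℝ) ^ s ≤ 6 := Real.rpow_le_self_of_one_le (by norm_num) hs1.le
    nlinarith
  have hGV : V / 4 ≤ volume.real G := by
    have h1 : V ≤ 2 * volume.real G0 := by
      have hfin : volume G0 ≠ ⊤ :=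
        ((measure_mono (fun x hx => hx.1)).trans_lt
          (measure_ball_lt_top (x := (0 : EE d)) (r := 1))).ne
      have := ENNReal.toReal_mono (ENNReal.mul_ne_top (by norm_num) hfin) hvol
      rw [ENNReal.toReal_mul] at this
      simpa [hV, measureReal_def] using this
    have h2 : volume.real ((fun y => x1 + y) ⁻¹' G0) = volume.real G0 := by
      rw [measureReal_def, measureReal_def, measure_preimage_add]
    have h3 : volume.real (ball (0 : EE d) (1/4)) ≤ V / 4 := by
      rw [measureReal_def, Measure.addHaar_ball _ _ (by norm_num), ENNReal.toReal_mul,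
        ENNReal.toReal_ofReal (by positivity), finrank_euclideanSpace_fin, ← measureReal_def, ← hV]
      have : ((1:ℝ)/4) ^ (d + 1) ≤ (1/4) ^ 1 :=
        pow_le_pow_of_le_one (by norm_num) (by norm_num) (by omega)
      nlinarith
    have h4 : volume.real ((fun y => x1 + y) ⁻¹' G0) ≤
        volume.real G + volume.real (ball (0 : EE d) (1/4)) := by
      refine (measureReal_mono (s₂ := G ∪ ball (0 : EE d) (1/4)) ?_ ?_).trans
        (measureReal_union_le _ _)
      · intro y hy
        by_cases h : 1/4 ≤ ‖y‖
        · exact Or.inl ⟨hy, h⟩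
        · right; rw [mem_ball_zero_iff]; linarith
      · exact (measure_union_lt_top hGfin.lt_top measure_ball_lt_top).ne
    linarith
  have hgm : Measurable g := by
    refine Measurable.ite (measurableSet_lt (by fun_prop) measurable_const) ?_ hw.measurable
    simp only [hφ]; fun_prop
  have hDm : Measurable D := by
    simp only [hD]
    exact (((hgm.comp (measurable_const_add x1)).add
      (hgm.comp (measurable_const.sub measurable_id))).div_const 2).sub_const _
  have hker : ∀ μ, SpecOK (d + 1) lam Lam μ →
      kerOp (d + 1) s μ g x1 ≤ (1 - s) * (-(q * (V / 4) / 2)) := by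
    intro μ hμ
    unfold kerOp
    rw [← hp]
    refine mul_le_mul_of_nonneg_left ?_ (by linarith)
    change ∫ y, D y * μ (‖y‖⁻¹ • y) / ‖y‖ ^ p ≤ _
    have hθ : ∀ y : EE d, y ≠ 0 → lam ≤ μ (‖y‖⁻¹ • y) ∧ μ (‖y‖⁻¹ • y) ≤ Lam := by
      intro y hy
      exact (hμ.2 _ (by rw [norm_smul, norm_inv, norm_norm, inv_mul_cancel₀ (norm_ne_zero_iff.2 hy)])).2
    have hD0 : D 0 = 0 := by rw [hin 0 (by simp)]; simp
    have hf : Integrable (fun y => D y * μ (‖y‖⁻¹ • y) / ‖y‖ ^ p) := by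
      refine Integrable.mono' (hJint.const_mul ((5 * ε + 416 * A) * Lam)) ?_ (.of_forall ?_)
      · refine Measurable.aestronglyMeasurable ?_
        refine (hDm.mul (hμ.1.comp (by fun_prop))).div (by fun_prop)
      · intro y
        by_cases hy : y = 0
        · rw [hy, hD0]; simp only [zero_mul, zero_div, norm_zero]
          exact mul_nonneg (by positivity) (hJ0 0)
        · obtain ⟨h1, h2⟩ := hθ y hy
          rw [norm_div, norm_mul, Real.norm_eq_abs, Real.norm_of_nonneg (hlam.le.trans h1),
            Real.norm_of_nonneg (by positivity : 0 ≤ ‖y‖ ^ p)]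
          simp only [hJ]
          rw [← mul_div_assoc]
          refine div_le_div_of_nonneg_right ?_ (by positivity)
          calc |D y| * μ (‖y‖⁻¹ • y) ≤
              ((5 * ε + 416 * A) * min (‖y‖ ^ (2:ℝ)) (‖y‖ ^ s)) * Lam :=
              mul_le_mul (hDabs y) h2 (hlam.le.trans h1) (by positivity)
            _ = _ := by ring
    have hGint : Integrable (G.indicator (fun _ => q)) :=
      (integrable_indicator_iff hGm).2 (integrableOn_const hGfin)
    have hr := (hJint.const_mul (5 * ε * Lam)).sub hGint
    refine (integral_mono hf hr ?_).trans ?_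
    · intro y
      simp only [Pi.sub_apply]
      by_cases hy : y = 0
      · have : (0 : EE d) ∉ G := by
          rintro ⟨_, h⟩
          rw [norm_zero] at h; linarith
        rw [hy, hD0, indicator_of_notMem this]; simp only [zero_mul, zero_div, sub_zero]
        exact mul_nonneg (by positivity) (hJ0 0)
      · obtain ⟨h1, h2⟩ := hθ y hy
        have hy0 : 0 < ‖y‖ := norm_pos_iff.2 hy
        have hk : 0 < ‖y‖ ^ p := by positivity
        by_cases hyG : y ∈ G
        · rw [indicator_of_mem hyG]
          have hb : D y * μ (‖y‖⁻¹ • y) / ‖y‖ ^ p ≤ - q := by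
            have e1 : D y * μ (‖y‖⁻¹ • y) ≤ -(lam / 16) := by nlinarith [hDG y hyG]
            have e2 : ‖y‖ ^ p ≤ 3 ^ p := by
              gcongr
              exact hGle y hyG
            have e3 : q ≤ lam / 16 / ‖y‖ ^ p := by
              rw [hq]
              gcongr
            calc D y * μ (‖y‖⁻¹ • y) / ‖y‖ ^ p ≤ -(lam / 16) / ‖y‖ ^ p := by gcongr
              _ ≤ _ := by rw [neg_div]; linarith
          have := mul_nonneg (by positivity : 0 ≤ 5 * ε * Lam) (hJ0 y)
          linarith
        · rw [indicator_of_notMem hyG, sub_zero]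
          simp only [hJ]
          rw [← mul_div_assoc]
          refine div_le_div_of_nonneg_right ?_ (by positivity)
          have hmin0 : 0 ≤ 5 * ε * min (‖y‖ ^ (2:ℝ)) (‖y‖ ^ s) := by positivity
          calc D y * μ (‖y‖⁻¹ • y) ≤ (5 * ε * min (‖y‖ ^ (2:ℝ)) (‖y‖ ^ s)) * μ (‖y‖⁻¹ • y) :=
                mul_le_mul_of_nonneg_right (hD5 y) (hlam.le.trans h1)
            _ ≤ (5 * ε * min (‖y‖ ^ (2:ℝ)) (‖y‖ ^ s)) * Lam :=
                mul_le_mul_of_nonneg_left h2 hmin0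
            _ = _ := by ring
    · have e1 : ∫ y, ((fun y => 5 * ε * Lam * J y) - G.indicator (fun _ => q)) y =
          5 * ε * Lam * I - volume.real G * q := by
        rw [integral_sub' (hJint.const_mul (5 * ε * Lam)) hGint, integral_const_mul,
          integral_indicator_const _ hGm, smul_eq_mul, hI]
      rw [e1]
      nlinarith
  have hneg : Mplus (d + 1) s lam Lam g x1 ≤ (1 - s) * (-(q * (V / 4) / 2)) := by
    unfold Mplus
    refine csSup_le ⟨_, fun _ => lam, ⟨measurable_const, fun _ _ => ⟨rfl, le_rfl, hlL⟩⟩, rfl⟩ ?_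
    rintro _ ⟨μ, hμ, rfl⟩
    exact hker μ hμ
  have hpos : 0 < (1 - s) * (q * (V / 4) / 2) := by
    have : 0 < 1 - s := by linarith
    positivity
  linarith

theorem liouville (d : ℕ) (s lam Lam : ℝ) (hs0 : 0 < s) (hs1 : s < 1)
    (ε : ℝ) (hε : 0 < ε) (hε1 : ε ≤ 1)
    (key : ∀ w : EE d → ℝ, Continuous w → ViscSub (d + 1) s lam Lam w univ →
      ∀ A : ℝ, (∀ x, |w x| ≤ A * (1 + ‖x‖) ^ s) → (∀ x, w x ≤ ε * (1 + ‖x‖) ^ s) →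
      ∀ x0, ‖x0‖ ≤ 1 → -ε ≤ w x0 →
      volume (ball (0 : EE d) 1) ≤ 2 * volume {x ∈ ball (0 : EE d) 1 | w x ≤ -(1/4)} → False)
    (w : EE d → ℝ) (hw : Continuous w) (hsub : ViscSub (d + 1) s lam Lam w univ)
    (hsup : ViscSuper (d + 1) s lam Lam w univ) (α A : ℝ) (hα : 0 < α) (hαs : α ≤ s * (ε / 2))
    (hA : ∀ x, |w x| ≤ A * (1 + ‖x‖) ^ α) : ∀ x y, w x = w y := by
  set N : EE d × EE d → ℝ := fun p => max 1 (max ‖p.1‖ ‖p.2‖) with hN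
  set F : EE d × EE d → ℝ := fun p => (w p.1 - w p.2) / (N p) ^ α with hF
  have hN1 : ∀ p, 1 ≤ N p := fun p => le_max_left _ _
  have hNa : ∀ p, ‖p.1‖ ≤ N p := fun p => (le_max_left _ _).trans (le_max_right _ _)
  have hNb : ∀ p, ‖p.2‖ ≤ N p := fun p => (le_max_right _ _).trans (le_max_right _ _)
  have hNp : ∀ p, 0 < (N p) ^ α := fun p => Real.rpow_pos_of_pos (by linarith [hN1 p]) _
  have hA0 : 0 ≤ A := by
    have := (abs_nonneg _).trans (hA 0)
    simpa using this
  have hαs' : α ≤ s := by nlinarith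
  have hbd : BddAbove (range F) := by
    refine ⟨2 * (A * 2 ^ α), ?_⟩
    rintro _ ⟨p, rfl⟩
    simp only [hF]
    rw [div_le_iff₀ (hNp p)]
    have e : ∀ z : EE d, ‖z‖ ≤ N p → |w z| ≤ A * 2 ^ α * (N p) ^ α := by
      intro z hz
      refine (hA z).trans ?_
      rw [mul_assoc, ← Real.mul_rpow (by norm_num) (by linarith [hN1 p])]
      gcongr
      linarith [hN1 p]
    have h1 := (le_abs_self _).trans (e _ (hNa p))
    have h2 := (neg_le_abs _).trans (e _ (hNb p))
    nlinarith
  set K := sSup (range F) with hK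
  have hKle : ∀ p, F p ≤ K := fun p => le_csSup hbd ⟨p, rfl⟩
  have hKle' : ∀ p, w p.1 - w p.2 ≤ K * (N p) ^ α := fun p => by
    have := hKle p
    simp only [hF] at this
    rwa [div_le_iff₀ (hNp p)] at this
  rcases le_or_gt K 0 with hK0 | hK0
  · intro x y
    have h1 := hKle' (x, y)
    have h2 := hKle' (y, x)
    have h3 := mul_nonpos_of_nonpos_of_nonneg hK0 (hNp (x, y)).le
    have h4 := mul_nonpos_of_nonpos_of_nonneg hK0 (hNp (y, x)).le
    simp only at h1 h2
    linarith
  exfalso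
  obtain ⟨_, ⟨⟨x, y⟩, rfl⟩, hxy⟩ := exists_lt_of_lt_csSup (range_nonempty F)
    (show (1 - ε / 2) * K < sSup (range F) by rw [← hK]; nlinarith)
  set R := N (x, y) with hR
  have hR1 : 1 ≤ R := hN1 _
  have hR0 : 0 < R := by linarith
  have hRa : 0 < R ^ α := hNp _
  have hKR : 0 < K * R ^ α := by positivity
  have hba : (1 - ε / 2) * (K * R ^ α) ≤ w x - w y := by
    simp only [hF] at hxy
    rw [lt_div_iff₀ (hNp _)] at hxy
    linarith [hxy]
  have hxR : ‖x‖ ≤ R := hNa (x, y)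
  have hyR : ‖y‖ ≤ R := hNb (x, y)
  -- growth
  have hgr : ∀ p q z : EE d, ‖p‖ ≤ R * max 1 ‖z‖ → ‖q‖ ≤ R * max 1 ‖z‖ →
      w p - w q ≤ K * R ^ α * (max 1 ‖z‖) ^ α := by
    intro p q z h1 h2
    have hRz : R ≤ R * max 1 ‖z‖ := le_mul_of_one_le_right hR0.le (le_max_left _ _)
    refine (hKle' (p, q)).trans ?_
    rw [mul_assoc, ← Real.mul_rpow hR0.le (by positivity)]
    have h0 : 0 ≤ N (p, q) := by linarith [hN1 (p, q)]
    have h3 : N (p, q) ≤ R * max 1 ‖z‖ := max_le (by linarith) (max_le h1 h2)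
    gcongr
  have hsm : ∀ z : EE d, ‖R • z‖ ≤ R * max 1 ‖z‖ := by
    intro z
    rw [norm_smul, Real.norm_of_nonneg hR0.le]
    gcongr
    exact le_max_right _ _
  have hRz : ∀ z : EE d, R ≤ R * max 1 ‖z‖ := fun z =>
    le_mul_of_one_le_right hR0.le (le_max_left _ _)
  have hbern : ∀ z : EE d, (max 1 ‖z‖) ^ α - (1 - ε / 2) ≤ ε * (1 + ‖z‖) ^ s := by
    intro z
    set t := max 1 ‖z‖ with ht
    have ht1 : 1 ≤ t := le_max_left _ _
    have hts : 1 ≤ t ^ s := Real.one_le_rpow ht1 hs0.le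
    have h1 := rpow_one_add_le_one_add_mul_self (s := t ^ s - 1) (by linarith) (p := α / s)
      (by positivity) ((div_le_one hs0).2 hαs')
    have h2 : (1 + (t ^ s - 1)) ^ (α / s) = t ^ α := by
      rw [add_sub_cancel, ← Real.rpow_mul (by linarith)]
      congr 1
      field_simp
    rw [h2] at h1
    have h3 : α / s ≤ ε / 2 := by rw [div_le_iff₀ hs0]; linarith
    have h4 : t ^ s ≤ (1 + ‖z‖) ^ s := by
      gcongr
      exact max_le (by linarith [norm_nonneg z]) (by linarith)
    have h5 : α / s * (t ^ s - 1) ≤ ε / 2 * (t ^ s - 1) := by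
      gcongr
    nlinarith
  have hc0 : 0 < (K * R ^ α)⁻¹ := by positivity
  -- general bound
  have hgen : ∀ v : EE d → ℝ, (∀ x, |v x| ≤ A * (1 + ‖x‖) ^ α) → ∀ b x,
      |(K * R ^ α)⁻¹ * (v (R • x) - b)| ≤
        ((K * R ^ α)⁻¹ * (A * R ^ s + |b|)) * (1 + ‖x‖) ^ s := by
    intro v hv b x
    rw [abs_mul, abs_of_pos hc0, mul_assoc]
    gcongr
    have h1 : |v (R • x) - b| ≤ |v (R • x)| + |b| := abs_sub _ _
    have hx1 : 1 ≤ 1 + ‖x‖ := by linarith [norm_nonneg x]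
    have h2 : |v (R • x)| ≤ A * R ^ s * (1 + ‖x‖) ^ s := by
      refine (hv _).trans ?_
      rw [mul_assoc, ← Real.mul_rpow hR0.le (by positivity)]
      gcongr
      have : 1 + ‖R • x‖ ≤ R * (1 + ‖x‖) := by
        rw [norm_smul, Real.norm_of_nonneg hR0.le]; linarith
      calc (1 + ‖R • x‖) ^ α ≤ (1 + ‖R • x‖) ^ s :=
            Real.rpow_le_rpow_of_exponent_le (by linarith [norm_nonneg (R • x)]) hαs'
        _ ≤ _ := by gcongr
    have h3 : 1 ≤ (1 + ‖x‖) ^ s := Real.one_le_rpow hx1 hs0.le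
    nlinarith [abs_nonneg b]
  have kW := key (fun z => (K * R ^ α)⁻¹ * (w (R • z) - w x)) (by fun_prop)
    (hsub.scale _ _ _ hc0 hR0) _ (hgen w hA _)
    (fun z => by
      refine le_trans ?_ (hbern z)
      rw [inv_mul_le_iff₀ hKR]
      have := hgr (R • z) y z (hsm z) (hyR.trans (hRz z))
      nlinarith)
    (R⁻¹ • x) (by
      rw [norm_smul, Real.norm_of_nonneg (by positivity), inv_mul_le_iff₀ hR0]; linarith)
    (by simp only [smul_inv_smul₀ hR0.ne']; simp; exact hε.le)
  have kV := key (fun z => (K * R ^ α)⁻¹ * (- w (R • z) - (- w y))) (by fun_prop)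
    (hsup.neg_sub.scale _ _ _ hc0 hR0) _ (hgen (fun x => - w x) (by simpa using hA) _)
    (fun z => by
      refine le_trans ?_ (hbern z)
      rw [inv_mul_le_iff₀ hKR]
      have := hgr x (R • z) z (hxR.trans (hRz z)) (hsm z)
      nlinarith)
    (R⁻¹ • y) (by
      rw [norm_smul, Real.norm_of_nonneg (by positivity), inv_mul_le_iff₀ hR0]; linarith)
    (by simp only [smul_inv_smul₀ hR0.ne']; simp; exact hε.le)
  set S1 := {z ∈ ball (0 : EE d) 1 | (K * R ^ α)⁻¹ * (w (R • z) - w x) ≤ -(1/4)}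
  set S2 := {z ∈ ball (0 : EE d) 1 | (K * R ^ α)⁻¹ * (- w (R • z) - (- w y)) ≤ -(1/4)}
  have hcov : ball (0 : EE d) 1 ⊆ S1 ∪ S2 := by
    intro z hz
    have hh : K * R ^ α / 2 ≤ w x - w y := by nlinarith
    by_cases h : w (R • z) ≤ (w x + w y) / 2
    · left
      refine ⟨hz, ?_⟩
      rw [inv_mul_le_iff₀ hKR]; linarith
    · right
      refine ⟨hz, ?_⟩
      rw [inv_mul_le_iff₀ hKR]; linarith
  have hm := (measure_mono hcov).trans (measure_union_le (μ := volume) S1 S2)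
  rcases le_total (volume S1) (volume S2) with h | h
  · exact kV (hm.trans (by rw [two_mul]; gcongr))
  · exact kW (hm.trans (by rw [two_mul]; gcongr))

theorem stmt13 (d : ℕ) (s lam Lam : ℝ) (hs0 : 0 < s) (hs1 : s < 1)
    (hlam : 0 < lam) (hlL : lam ≤ Lam) :
    ∃ abar : ℝ, 0 < abar ∧
      ∀ u : EuclideanSpace ℝ (Fin (d + 1)) → ℝ, Continuous u →
        (∀ h : EuclideanSpace ℝ (Fin (d + 1)),
          ViscSub (d + 1) s lam Lam (fun x => u (x + h) - u x) Set.univ ∧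
          ViscSuper (d + 1) s lam Lam (fun x => u (x + h) - u x) Set.univ) →
        ∀ β α C : ℝ, 0 < β → β < 1 → 0 < α → α < abar →
          (∀ R : ℝ, 1 ≤ R → ∀ x y : EuclideanSpace ℝ (Fin (d + 1)),
            ‖x‖ < R → ‖y‖ < R → |u x - u y| ≤ C * R ^ α * ‖x - y‖ ^ β) →
          ∃ (p : EuclideanSpace ℝ (Fin (d + 1))) (b : ℝ),
            ∀ x : EuclideanSpace ℝ (Fin (d + 1)), u x = ⟪p, x⟫ + b := by
  obtain ⟨ε, hε, hε1, key⟩ := key_lemma d s lam Lam hs0 hs1 hlam hlL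
  refine ⟨s * (ε / 2), by positivity, ?_⟩
  intro u hu hvisc β α C hβ0 hβ1 hα0 hα hgrow
  have hconst : ∀ h x y : EE d, u (x + h) - u x = u (y + h) - u y := by
    intro h
    refine liouville d s lam Lam hs0 hs1 ε hε hε1 key (fun x => u (x + h) - u x) (by fun_prop)
      (hvisc h).1 (hvisc h).2 α (|C| * (1 + ‖h‖) ^ α * ‖h‖ ^ β) hα0 hα.le ?_
    intro x
    have := hgrow ((1 + ‖h‖) * (1 + ‖x‖)) (by nlinarith [norm_nonneg x, norm_nonneg h]) (x + h) x
      (by have := norm_add_le x h; nlinarith [norm_nonneg x, norm_nonneg h])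
      (by nlinarith [norm_nonneg x, norm_nonneg h])
    rw [add_sub_cancel_left, Real.mul_rpow (by positivity) (by positivity)] at this
    refine this.trans ?_
    have : C * ((1 + ‖h‖) ^ α * (1 + ‖x‖) ^ α) * ‖h‖ ^ β ≤
      |C| * ((1 + ‖h‖) ^ α * (1 + ‖x‖) ^ α) * ‖h‖ ^ β := by
      gcongr
      exact le_abs_self C
    linarith
  let f : EE d →+ ℝ :=
    { toFun := fun x => u x - u 0
      map_zero' := by simp
      map_add' := fun x y => by
        have := hconst y x 0
        rw [zero_add] at this
        linarith }
  have hf : Continuous f := by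
    change Continuous (fun x => u x - u 0)
    fun_prop
  refine ⟨(InnerProductSpace.toDual ℝ (EE d)).symm (f.toRealLinearMap hf), u 0, fun x => ?_⟩
  rw [InnerProductSpace.toDual_symm_apply]
  change u x = (u x - u 0) + u 0
  ring
end

section
/- Odd-kernel cancellation: let s ∈ (0,1) and let a₂ : ℝⁿ × S^{n-1} → ℝ be bounded with a₂(x,−θ) = −a₂(x,θ). Then for every x ∈ ℝⁿ with x_n > 0, the principal value integral PV ∫_{ℝⁿ} ((x_n + y_n)_+)^{s−1} · a₂(x, y/|y|) |y|^{-n-2s+1} dy equals 0, where (t)_+^{s−1} denotes t^{s−1} for t > 0 and 0 otherwise. -/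
open MeasureTheory Set Filter

noncomputable def pp (s t : ℝ) : ℝ := if 0 < t then t ^ (s - 1) else 0

lemma polar_bound {E : Type*} [NormedAddCommGroup E] [NormedSpace ℝ E] [Nontrivial E]
    [FiniteDimensional ℝ E] [MeasurableSpace E] [BorelSpace E] (μ : Measure E)
    [μ.IsAddHaarMeasure] (f : E → ℝ) (hf : Integrable f μ) (B : ℝ)
    (hB : ∀ θ : E, ‖θ‖ = 1 →
      ‖∫ r in Ioi (0:ℝ), r ^ (Module.finrank ℝ E - 1) * f (r • θ)‖ ≤ B) :
    ‖∫ y, f y ∂μ‖ ≤ B * μ.toSphere.real univ := by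
  let g : Metric.sphere (0:E) 1 × Ioi (0:ℝ) → ℝ := fun z => f (z.2.1 • z.1.1)
  have hcomp : g ∘ (homeomorphUnitSphereProd E) = fun y : ({0}ᶜ : Set E) => f y.1 := by
    funext y
    have hy : ‖(y:E)‖ ≠ 0 := norm_ne_zero_iff.2 y.2
    simp [g, smul_smul, hy]
  have hmp := μ.measurePreserving_homeomorphUnitSphereProd
  have hint : Integrable g (μ.toSphere.prod (.volumeIoiPow (Module.finrank ℝ E - 1))) := by
    rw [← hmp.integrable_comp_emb (Homeomorph.measurableEmbedding _), hcomp]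
    have := (integrableOn_iff_comap_subtypeVal (μ := μ) (f := f) (s := ({0}ᶜ : Set E))
      (measurableSet_singleton _).compl).1 hf.integrableOn
    exact this
  have h1 : ∫ y, f y ∂μ = ∫ z, g z ∂(μ.toSphere.prod (.volumeIoiPow (Module.finrank ℝ E - 1))) := by
    rw [← hmp.integral_comp (Homeomorph.measurableEmbedding _) g]
    have : ∀ y, g (homeomorphUnitSphereProd E y) = f y.1 := fun y => congrFun hcomp y
    simp_rw [this]
    rw [integral_subtype_comap (measurableSet_singleton _).compl f, restrict_compl_singleton]
  rw [h1, integral_prod _ hint]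
  refine norm_integral_le_of_norm_le_const (.of_forall fun θ => ?_)
  have h2 : ∫ r, g (θ, r) ∂(Measure.volumeIoiPow (Module.finrank ℝ E - 1))
      = ∫ r in Ioi (0:ℝ), r ^ (Module.finrank ℝ E - 1) * f (r • θ.1) := by
    simp only [Measure.volumeIoiPow, ENNReal.ofReal]
    rw [integral_withDensity_eq_integral_smul
        ((measurable_subtype_coe.pow_const _).real_toNNReal),
      integral_subtype_comap measurableSet_Ioi
        fun a ↦ Real.toNNReal (a ^ (Module.finrank ℝ E - 1)) • f (a • θ.1),
      setIntegral_congr_fun measurableSet_Ioi fun x hx ↦ ?_]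
    rw [NNReal.smul_def, Real.coe_toNNReal _ (pow_nonneg hx.out.le _), smul_eq_mul]
  rw [h2]
  exact hB θ.1 (by simpa using θ.2)

lemma oneD_pos (s X c ε : ℝ) (hs0 : 0 < s) (hs1 : s < 1) (hX : 0 < X) (hc : 0 < c) (hc1 : c ≤ 1)
    (hε : 0 < ε) (hεX : ε ≤ X / 2) :
    ‖∫ r in Ioi ε, (pp s (X + r * c) - pp s (X - r * c)) * r ^ (-(2 * s))‖
      ≤ (2 / X) * X ^ (s - 1) * (ε ^ (2:ℝ) * ε ^ (-(2 * s))) := by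
  have hεc : ε * c ≤ X / 2 := by nlinarith
  have hXεc : 0 < X - ε * c := by linarith
  set ε' := ε * X / (X - ε * c) with hε'
  have hle : ε ≤ ε' := by
    rw [hε', le_div_iff₀ hXεc]; nlinarith [mul_pos hε (mul_pos hε hc)]
  have hε'0 : 0 < ε' := lt_of_lt_of_le hε hle
  let P : ℝ → ℝ := fun r => pp s (X + r * c) * r ^ (-(2 * s))
  let N : ℝ → ℝ := fun r => pp s (X - r * c) * r ^ (-(2 * s))
  have hPeq : ∀ r, 0 < r → P r = (X + r * c) ^ (s - 1) * r ^ (-(2 * s)) := by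
    intro r hr
    have : 0 < X + r * c := by positivity
    simp [P, pp, this]
  have hPm : ContinuousOn (fun r : ℝ => (X + r * c) ^ (s - 1) * r ^ (-(2 * s))) (Ioi 0) := by
    intro r hr
    have hr : 0 < r := hr
    have : 0 < X + r * c := by positivity
    apply ContinuousAt.continuousWithinAt
    refine ContinuousAt.mul (ContinuousAt.rpow_const (by fun_prop) (Or.inl this.ne'))
      (ContinuousAt.rpow_const (by fun_prop) (Or.inl hr.ne'))
  have hPint : IntegrableOn P (Ioi ε) := by
    have hb : IntegrableOn (fun r : ℝ => c ^ (s - 1) * r ^ (-1 - s)) (Ioi ε) :=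
      (integrableOn_Ioi_rpow_of_lt (by linarith) hε).const_mul _
    have h' : IntegrableOn (fun r : ℝ => (X + r * c) ^ (s - 1) * r ^ (-(2 * s))) (Ioi ε) := by
      refine Integrable.mono' hb ((hPm.mono (Ioi_subset_Ioi hε.le)).aestronglyMeasurable
        measurableSet_Ioi) ?_
      filter_upwards [ae_restrict_mem measurableSet_Ioi] with r hr
      have hr : 0 < r := hε.trans hr
      have h3 : 0 < X + r * c := by positivity
      rw [Real.norm_of_nonneg (by positivity)]
      have h4 : (X + r * c) ^ (s - 1) ≤ (c * r) ^ (s - 1) :=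
        Real.rpow_le_rpow_of_nonpos (by positivity) (by nlinarith) (by linarith)
      calc _ ≤ (c * r) ^ (s - 1) * r ^ (-(2 * s)) := by gcongr
        _ = c ^ (s - 1) * (r ^ (s - 1) * r ^ (-(2 * s))) := by
          rw [Real.mul_rpow hc.le hr.le]; ring
        _ = _ := by rw [← Real.rpow_add hr]; congr 2; ring
    exact h'.congr_fun (fun r hr => (hPeq r (hε.trans hr)).symm) measurableSet_Ioi
  let φ : ℝ → ℝ := fun u => u * X / (X + u * c)
  let φ' : ℝ → ℝ := fun u => X ^ 2 / (X + u * c) ^ 2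
  have hφd : ∀ u ∈ Ioi ε', HasDerivWithinAt φ (φ' u) (Ioi ε') u := by
    intro u hu
    have hu : 0 < u := hε'0.trans hu
    have h3 : X + u * c ≠ 0 := by positivity
    apply HasDerivAt.hasDerivWithinAt
    have := ((hasDerivAt_id u).mul_const X).div
      (((hasDerivAt_id u).mul_const c).const_add X) h3
    refine HasDerivAt.congr_deriv (f := φ) this ?_
    show _ = X ^ 2 / (X + u * c) ^ 2
    simp only [id]
    congr 1
    ring
  have hinj : InjOn φ (Ioi ε') := by
    intro u hu v hv huv
    have hu : 0 < u := hε'0.trans hu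
    have hv : 0 < v := hε'0.trans hv
    have h3 : X + u * c ≠ 0 := by positivity
    have h4 : X + v * c ≠ 0 := by positivity
    simp only [φ] at huv
    rw [div_eq_div_iff h3 h4] at huv
    have : X * X * (u - v) = 0 := by linear_combination huv
    have h5 : X * X ≠ 0 := by positivity
    have := (mul_eq_zero.1 this).resolve_left h5
    linarith
  have himg : φ '' Ioi ε' = Ioo ε (X / c) := by
    ext r
    constructor
    · rintro ⟨u, hu, rfl⟩
      have hu' : ε' < u := hu
      have hu0 : 0 < u := hε'0.trans hu
      have h3 : 0 < X + u * c := by positivity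
      rw [hε', div_lt_iff₀ hXεc] at hu'
      refine ⟨?_, ?_⟩
      · simp only [φ]; rw [lt_div_iff₀ h3]; nlinarith
      · simp only [φ]; rw [div_lt_div_iff₀ h3 hc]; nlinarith [mul_pos hX hX]
    · rintro ⟨h1, h2⟩
      rw [lt_div_iff₀ hc] at h2
      have h3 : 0 < X - r * c := by linarith
      refine ⟨r * X / (X - r * c), ?_, ?_⟩
      · show ε' < _
        rw [hε', div_lt_div_iff₀ hXεc h3]
        nlinarith [mul_pos hX (sub_pos.2 h1)]
      · simp only [φ]
        have h4 : X + r * X / (X - r * c) * c = X ^ 2 / (X - r * c) := by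
          field_simp; ring
        rw [h4]
        field_simp
  have hkey : ∀ u ∈ Ioi ε', |φ' u| • N (φ u) = P u := by
    intro u hu
    have hu : 0 < u := hε'0.trans hu
    have h3 : 0 < X + u * c := by positivity
    rw [hPeq u hu]
    have h4 : X - φ u * c = X ^ 2 / (X + u * c) := by
      simp only [φ]; field_simp; ring
    have h5 : 0 < X ^ 2 / (X + u * c) := by positivity
    simp only [N, pp, h4, h5, if_true, smul_eq_mul, φ, φ']
    rw [abs_of_pos (by positivity)]
    have e1 : X ^ 2 / (X + u * c) ^ 2 = X ^ (2:ℝ) * (X + u * c) ^ (-2:ℝ) := by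
      rw [Real.rpow_neg h3.le, div_eq_mul_inv]; norm_cast
    have e2 : (X ^ 2 / (X + u * c)) ^ (s - 1) = X ^ (2 * (s - 1)) * (X + u * c) ^ (-(s - 1)) := by
      rw [Real.div_rpow (by positivity) h3.le, Real.rpow_neg h3.le, Real.rpow_mul hX.le,
        div_eq_mul_inv]; norm_cast
    have e3 : (u * X / (X + u * c)) ^ (-(2 * s))
        = u ^ (-(2 * s)) * X ^ (-(2 * s)) * (X + u * c) ^ (2 * s) := by
      rw [Real.div_rpow (by positivity) h3.le, Real.mul_rpow hu.le hX.le, Real.rpow_neg h3.le,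
        div_inv_eq_mul]
    rw [e1, e2, e3]
    have e4 : X ^ (2:ℝ) * X ^ (2 * (s - 1)) * X ^ (-(2 * s)) = 1 := by
      rw [← Real.rpow_add hX, ← Real.rpow_add hX]
      convert Real.rpow_zero X using 2; ring
    have e5 : (X + u * c) ^ (-2:ℝ) * (X + u * c) ^ (-(s - 1)) * (X + u * c) ^ (2 * s)
        = (X + u * c) ^ (s - 1) := by
      rw [← Real.rpow_add h3, ← Real.rpow_add h3]
      congr 1; ring
    rw [← e5]
    linear_combination ((X + u * c) ^ (-2:ℝ) * (X + u * c) ^ (-(s - 1)) * (X + u * c) ^ (2 * s)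
      * u ^ (-(2 * s))) * e4
  have hPint' : IntegrableOn P (Ioi ε') := hPint.mono_set (Ioi_subset_Ioi hle)
  have hNint0 : IntegrableOn N (Ioo ε (X / c)) := by
    rw [← himg, integrableOn_image_iff_integrableOn_abs_deriv_smul measurableSet_Ioi hφd hinj]
    exact hPint'.congr_fun (fun u hu => (hkey u hu).symm) measurableSet_Ioi
  have hN0 : ∀ r ∈ Ioi ε \ Ioo ε (X / c), N r = 0 := by
    rintro r ⟨h1, h2⟩
    have : X / c ≤ r := by
      by_contra h
      exact h2 ⟨h1, not_le.1 h⟩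
    rw [div_le_iff₀ hc] at this
    have h6 : ¬ (r * c < X) := by linarith
    simp [N, pp, h6]
  have hNint : IntegrableOn N (Ioi ε) :=
    hNint0.of_forall_sdiff_eq_zero measurableSet_Ioi hN0
  have hNeq : ∫ r in Ioi ε, N r = ∫ r in Ioi ε', P r := by
    rw [setIntegral_eq_of_subset_of_forall_sdiff_eq_zero measurableSet_Ioi
      Ioo_subset_Ioi_self hN0, ← himg,
      integral_image_eq_integral_abs_deriv_smul measurableSet_Ioi hφd hinj]
    exact setIntegral_congr_fun measurableSet_Ioi hkey
  have hsplit : ∫ r in Ioi ε, P r = (∫ r in Ioc ε ε', P r) + ∫ r in Ioi ε', P r := by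
    rw [← setIntegral_union (Ioc_disjoint_Ioi le_rfl) measurableSet_Ioi
      (hPint.mono_set Ioc_subset_Ioi_self) hPint', Ioc_union_Ioi_eq_Ioi hle]
  have hD : ∫ r in Ioi ε, (pp s (X + r * c) - pp s (X - r * c)) * r ^ (-(2 * s))
      = ∫ r in Ioc ε ε', P r := by
    have : ∀ r, (pp s (X + r * c) - pp s (X - r * c)) * r ^ (-(2 * s)) = P r - N r := by
      intro r; simp only [P, N]; ring
    simp_rw [this]
    rw [integral_sub hPint hNint, hNeq, hsplit]; ring
  rw [hD]
  have hbound : ∀ r ∈ Ioc ε ε', ‖P r‖ ≤ X ^ (s - 1) * ε ^ (-(2 * s)) := by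
    intro r hr
    have hr0 : 0 < r := hε.trans hr.1
    have h3 : 0 < X + r * c := by positivity
    rw [hPeq r hr0, Real.norm_of_nonneg (by positivity)]
    exact mul_le_mul (Real.rpow_le_rpow_of_nonpos hX (by nlinarith) (by linarith))
      (Real.rpow_le_rpow_of_nonpos hε hr.1.le (by linarith)) (by positivity) (by positivity)
  have h7 := norm_setIntegral_le_of_norm_le_const (μ := volume) (by simp) hbound
  refine h7.trans ?_
  have h8 : volume.real (Ioc ε ε') ≤ 2 / X * ε ^ (2:ℝ) := by
    rw [Real.volume_real_Ioc_of_le hle, hε']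
    have : ε * X / (X - ε * c) - ε = ε ^ 2 * c / (X - ε * c) := by
      field_simp; ring
    rw [this, div_le_iff₀ hXεc]
    have h9 : 2 / X * ε ^ (2:ℝ) * (X / 2) ≤ 2 / X * ε ^ (2:ℝ) * (X - ε * c) := by
      gcongr; linarith
    refine le_trans ?_ h9
    have : 2 / X * ε ^ (2:ℝ) * (X / 2) = ε ^ 2 := by
      rw [Real.rpow_two]; field_simp
    rw [this]
    nlinarith [sq_nonneg ε]
  calc _ ≤ X ^ (s - 1) * ε ^ (-(2 * s)) * (2 / X * ε ^ (2:ℝ)) := by gcongr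
    _ = _ := by ring

lemma oneD (s X c ε : ℝ) (hs0 : 0 < s) (hs1 : s < 1) (hX : 0 < X) (hc1 : |c| ≤ 1)
    (hε : 0 < ε) (hεX : ε ≤ X / 2) :
    ‖∫ r in Ioi ε, (pp s (X + r * c) - pp s (X - r * c)) * r ^ (-(2 * s))‖
      ≤ (2 / X) * X ^ (s - 1) * (ε ^ (2:ℝ) * ε ^ (-(2 * s))) := by
  rcases lt_trichotomy c 0 with hc | hc | hc
  · have := oneD_pos s X (-c) ε hs0 hs1 hX (by linarith) (by linarith [(abs_le.1 hc1).1]) hε hεX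
    rw [← norm_neg, ← integral_neg] at this
    have e : ∀ r : ℝ, -((pp s (X + r * -c) - pp s (X - r * -c)) * r ^ (-(2 * s)))
        = (pp s (X + r * c) - pp s (X - r * c)) * r ^ (-(2 * s)) := by
      intro r
      rw [mul_neg, sub_neg_eq_add, ← sub_eq_add_neg]
      ring
    simp_rw [e] at this
    exact this
  · subst hc
    simp
    positivity
  · exact oneD_pos s X c ε hs0 hs1 hX hc (abs_le.1 hc1).2 hε hεX

/-- Odd-kernel cancellation: if `a₂(x,·)` is bounded, measurable, and odd on the unit
sphere, then for `x` with `x_n > 0` the principal value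
`PV ∫_{ℝⁿ} ((x_n+y_n)_+)^{s-1} a₂(x, y/|y|) |y|^{-n-2s+1} dy` vanishes, the principal
value being taken as the limit of the integrals over `{|y| > ε}` as `ε → 0⁺`. -/
theorem stmt19 (d : ℕ) (s : ℝ) (hs0 : 0 < s) (hs1 : s < 1)
    (a₂ : EuclideanSpace ℝ (Fin (d + 1)) → EuclideanSpace ℝ (Fin (d + 1)) → ℝ)
    (M : ℝ) (hmeas : ∀ x, Measurable (a₂ x)) (hbdd : ∀ x θ, |a₂ x θ| ≤ M)
    (hodd : ∀ (x θ : EuclideanSpace ℝ (Fin (d + 1))), ‖θ‖ = 1 → a₂ x (-θ) = -a₂ x θ)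
    (x : EuclideanSpace ℝ (Fin (d + 1))) (hx : 0 < x (Fin.last d)) :
    Tendsto (fun ε : ℝ =>
        ∫ y in {y : EuclideanSpace ℝ (Fin (d + 1)) | ε < ‖y‖},
          (if 0 < x (Fin.last d) + y (Fin.last d) then
              (x (Fin.last d) + y (Fin.last d)) ^ (s - 1) else 0)
            * a₂ x (‖y‖⁻¹ • y) / ‖y‖ ^ ((d : ℝ) + 2 * s))
      (nhdsWithin 0 (Ioi 0)) (nhds 0) := by
  set X := x (Fin.last d) with hXdef
  set V := (volume : Measure (EuclideanSpace ℝ (Fin (d + 1)))).toSphere.real univ with hV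
  have hM : 0 ≤ M := (abs_nonneg _).trans (hbdd x 0)
  have hV0 : 0 ≤ V := measureReal_nonneg
  refine squeeze_zero_norm' (a := fun ε : ℝ =>
    M * ((2 / X) * X ^ (s - 1) * (ε ^ (2 - 2 * s))) * V) ?_ ?_
  swap
  · have h1 : Tendsto (fun ε : ℝ => ε ^ (2 - 2 * s)) (nhdsWithin 0 (Ioi 0)) (nhds 0) := by
      have : ContinuousAt (fun ε : ℝ => ε ^ (2 - 2 * s)) 0 :=
        Real.continuousAt_rpow_const _ _ (Or.inr (by linarith))
      have h2 := this.tendsto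
      rw [Real.zero_rpow (by linarith)] at h2
      exact h2.mono_left nhdsWithin_le_nhds
    have := ((h1.const_mul (2 / X * X ^ (s - 1))).const_mul M).mul_const V
    simpa using this
  have hev : ∀ᶠ ε in nhdsWithin (0:ℝ) (Ioi 0), ε ∈ Ioc 0 (X / 2) := 
    Ioc_mem_nhdsGT (by positivity)
  filter_upwards [hev] with ε hε
  obtain ⟨hε0, hεX⟩ := hε
  set S := {y : EuclideanSpace ℝ (Fin (d + 1)) | ε < ‖y‖} with hS
  have hSm : MeasurableSet S := measurableSet_lt measurable_const measurable_norm
  set G : EuclideanSpace ℝ (Fin (d + 1)) → ℝ := fun y =>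
    (if 0 < X + y (Fin.last d) then (X + y (Fin.last d)) ^ (s - 1) else 0)
            * a₂ x (‖y‖⁻¹ • y) / ‖y‖ ^ ((d : ℝ) + 2 * s) with hG
  have hGpp : ∀ y, G y = pp s (X + y (Fin.last d)) * a₂ x (‖y‖⁻¹ • y) / ‖y‖ ^ ((d : ℝ) + 2 * s) :=
    fun y => rfl
  rw [← integral_indicator hSm]
  set f := S.indicator G with hf
  by_cases hfi : Integrable f; swap
  · rw [integral_undef hfi, norm_zero]
    positivity
  have hk : ∫ y, f y = (1 / 2) * ∫ y, (f y + f (-y)) := by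
    rw [integral_add hfi hfi.comp_neg, integral_neg_eq_self]; ring
  have hki : Integrable (fun y => f y + f (-y)) := hfi.add hfi.comp_neg
  have hE : ε ^ (2 - 2 * s) = ε ^ (2:ℝ) * ε ^ (-(2 * s)) := by
    rw [← Real.rpow_add hε0]; congr 1
  have := polar_bound volume (fun y => f y + f (-y)) hki
    (M * ((2 / X) * X ^ (s - 1) * (ε ^ (2 - 2 * s)))) ?_
  · rw [hk, norm_mul]
    have h2 : ‖(1 / 2 : ℝ)‖ = 1 / 2 := by norm_num
    rw [h2]
    linarith [norm_nonneg (∫ y, (f y + f (-y)))]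
  intro θ hθ
  have hc : |θ (Fin.last d)| ≤ 1 := by
    have := PiLp.norm_apply_le θ (Fin.last d)
    rw [hθ] at this
    simpa using this
  have h1 : ∫ r in Ioi (0:ℝ), r ^ (Module.finrank ℝ (EuclideanSpace ℝ (Fin (d + 1))) - 1)
        * (f (r • θ) + f (-(r • θ)))
      = a₂ x θ * ∫ r in Ioi ε, (pp s (X + r * θ (Fin.last d)) - pp s (X - r * θ (Fin.last d)))
        * r ^ (-(2 * s)) := by
    rw [← integral_const_mul]
    rw [setIntegral_eq_of_subset_of_forall_sdiff_eq_zero (s := Ioi ε) (t := Ioi 0) measurableSet_Ioi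
      (Ioi_subset_Ioi hε0.le)]
    · refine setIntegral_congr_fun measurableSet_Ioi fun r hr => ?_
      have hr : ε < r := hr
      have hr0 : 0 < r := hε0.trans hr
      have hn : ‖r • θ‖ = r := by rw [norm_smul, hθ, Real.norm_of_nonneg hr0.le, mul_one]
      have m1 : r • θ ∈ S := by simp only [hS, mem_ofPred_eq, hn]; exact hr
      have m2 : -(r • θ) ∈ S := by simp only [hS, mem_ofPred_eq, norm_neg, hn]; exact hr
      have hu : r⁻¹ • (r • θ) = θ := by rw [smul_smul, inv_mul_cancel₀ hr0.ne', one_smul]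
      simp only [hf, indicator_of_mem m1, indicator_of_mem m2, hGpp, norm_neg, hn, smul_neg, hu,
        hodd x θ hθ, finrank_euclideanSpace, Fintype.card_fin, Nat.add_sub_cancel]
      have e1 : r ^ ((d:ℝ) + 2 * s) = r ^ d * r ^ (2 * s) := by
        rw [Real.rpow_add hr0, Real.rpow_natCast]
      rw [e1, Real.rpow_neg hr0.le]
      have : 0 < r ^ (2 * s) := by positivity
      simp only [PiLp.smul_apply, PiLp.neg_apply, smul_eq_mul, ← sub_eq_add_neg]
      field_simp
      ring
    · rintro r ⟨h1, h2⟩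
      have h1 : 0 < r := h1
      have h2 : r ≤ ε := not_lt.1 h2
      have hn : ‖r • θ‖ = r := by rw [norm_smul, hθ, Real.norm_of_nonneg h1.le, mul_one]
      have m1 : r • θ ∉ S := by simp only [hS, mem_ofPred_eq, hn]; exact not_lt.2 h2
      have m2 : -(r • θ) ∉ S := by simp only [hS, mem_ofPred_eq, norm_neg, hn]; exact not_lt.2 h2
      simp [hf, m1, m2]
  rw [h1, norm_mul, hE]
  exact mul_le_mul (hbdd x θ) (oneD s X _ ε hs0 hs1 hx hc hε0 hεX) (norm_nonneg _) hM
end
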